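/- For i = 1, 2, let X_i be a random variable taking values in a measurable space Ω_i (both defined on the same probability space), and let φ_i be a measurable function from Ω_i to a measurable space E_i. Then for every f ∈ 𝔽: S_f(φ₁(X₁), φ₂(X₂)) ≤ S_f(X₁, X₂). -/

import Mathlib

open MeasureTheory ProbabilityTheory Filter Set Topology
open scoped ENNReal NNReal

noncomputable section

/-- Extended-real positive part, as a value in `ℝ≥0∞`. -/
def EReal.toENNReal' (x : EReal) : ℝ≥0∞ :=
  if x = ⊤ then ⊤ else ENNReal.ofReal x.toReal

/-- Quasi-integrability of an extended-real-valued function: the positive part or the negative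
part has finite integral. -/
def QuasiIntegrable {Ω : Type*} [MeasurableSpace Ω] (μ : Measure Ω) (g : Ω → EReal) : Prop :=
  (∫⁻ ω, (g ω).toENNReal' ∂μ) < ⊤ ∨ (∫⁻ ω, (-(g ω)).toENNReal' ∂μ) < ⊤

/-- The integral of an extended-real-valued function, defined as the difference of the
integrals of the positive and negative parts. -/
def eInt {Ω : Type*} [MeasurableSpace Ω] (μ : Measure Ω) (g : Ω → EReal) : EReal :=
  ((∫⁻ ω, (g ω).toENNReal' ∂μ : ℝ≥0∞) : EReal) - ((∫⁻ ω, (-(g ω)).toENNReal' ∂μ : ℝ≥0∞) : EReal)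

/-- `f` is strictly convex at the point `z`. -/
def StrictConvexAt (f : ℝ → EReal) (z : ℝ) : Prop :=
  ∀ x y α : ℝ, x ≠ z → y ≠ z → 0 < α → α < 1 → z = α * x + (1 - α) * y →
    f z < (α : EReal) * f x + ((1 - α : ℝ) : EReal) * f y

/-- The class `𝔽` of proper convex functions `f : ℝ → (-∞, +∞]` with domain contained in
`[0, ∞)`, right-continuous at `0`, with `f 1 = 0` and `1` in the interior of the domain. -/
structure MemF (f : ℝ → EReal) : Prop where
  ne_bot : ∀ x, f x ≠ ⊥
  convex : ∀ x y α : ℝ, 0 ≤ α → α ≤ 1 →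
    f (α * x + (1 - α) * y) ≤ (α : EReal) * f x + ((1 - α : ℝ) : EReal) * f y
  top_of_neg : ∀ x : ℝ, x < 0 → f x = ⊤
  right_continuous_at_zero : Tendsto f (nhdsWithin 0 (Set.Ioi 0)) (nhds (f 0))
  one_eq_zero : f 1 = 0
  one_mem_interior_dom : ∃ ε : ℝ, 0 < ε ∧ ∀ x : ℝ, |x - 1| < ε → f x ≠ ⊤

/-- The value `f*(0) = lim_{t → ∞} f(t)/t` of the convex conjugate at `0`. -/
def fStarZero (f : ℝ → EReal) : EReal :=
  Filter.limsup (fun t : ℝ => ((t⁻¹ : ℝ) : EReal) * f t) Filter.atTop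

/-- The convex conjugate `f*` of `f ∈ 𝔽`: `f*(t) = t f(1/t)` for `t > 0`,
`f*(0) = lim_{t→∞} f(t)/t`, and `f* = ⊤` on negative reals. -/
def fConj (f : ℝ → EReal) : ℝ → EReal := fun t =>
  if 0 < t then ((t : ℝ) : EReal) * f t⁻¹
  else if t = 0 then fStarZero f
  else ⊤

/-- The ratio `dP/dQ` defined `(P+Q)`-a.e. via densities w.r.t. `λ = P + Q`, with the
conventions `0/0 = ∞/∞ = 0` (which are those of `ℝ≥0∞` division). -/
def rnRatio {Ω : Type*} [MeasurableSpace Ω] (P Q : Measure Ω) : Ω → ℝ≥0∞ :=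
  fun ω => P.rnDeriv (P + Q) ω / Q.rnDeriv (P + Q) ω

/-- Extension of `f : ℝ → EReal` to `[0, ∞]`, with value `⊤` at `∞`. -/
def extF (f : ℝ → EReal) : ℝ≥0∞ → EReal :=
  fun x => if x = ⊤ then ⊤ else f x.toReal

/-- The `f`-divergence `D_f(P‖Q) = ∫ f(dP/dQ) dQ + f*(0) P(dP/dQ = ∞)`.
Note that `Q(dP/dQ = ∞) = 0`, and that in `EReal` one has `f*(0) · 0 = 0`, which encodes the
convention that the second term vanishes when `P(dP/dQ = ∞) = 0`. -/
def fDiv {Ω : Type*} [MeasurableSpace Ω] (f : ℝ → EReal) (P Q : Measure Ω) : EReal :=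
  eInt Q (fun ω => extF f (rnRatio P Q ω)) +
    fStarZero f * ((P {ω | rnRatio P Q ω = ⊤} : ℝ≥0∞) : EReal)

/-- The Csiszár index `S_f(X,Y) = D_f(P_X ⊗ P_Y ‖ P_{(X,Y)})`. -/
def csiszarIndex {Ω α β : Type*} [MeasurableSpace Ω] [MeasurableSpace α] [MeasurableSpace β]
    (f : ℝ → EReal) (μ : Measure Ω) (X : Ω → α) (Y : Ω → β) : EReal :=
  fDiv f ((μ.map X).prod (μ.map Y)) (μ.map (fun ω => (X ω, Y ω)))

section Ratio

variable {Ω : Type*} [MeasurableSpace Ω] {P Q : Measure Ω}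

lemma measurable_rnRatio : Measurable (rnRatio P Q) :=
  (Measure.measurable_rnDeriv _ _).div (Measure.measurable_rnDeriv _ _)

lemma measurableSet_rnRatio_eq_top : MeasurableSet {ω | rnRatio P Q ω = ⊤} :=
  measurable_rnRatio (measurableSet_singleton ⊤)

variable [IsFiniteMeasure P] [IsFiniteMeasure Q]

lemma measure_rnRatio_eq_top : Q {ω | rnRatio P Q ω = ⊤} = 0 := by
  have h : ∀ᵐ ω ∂Q, rnRatio P Q ω ≠ ⊤ := by
    filter_upwards [Measure.rnDeriv_eq_div_rnDeriv_add P Q, P.rnDeriv_lt_top Q] with ω h₁ h₂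
    exact ne_of_lt (h₁.symm.trans_lt h₂)
  simpa [ae_iff] using h

lemma ae_rnRatio_ne_top : ∀ᵐ ω ∂Q, rnRatio P Q ω ≠ ⊤ := by
  simpa [ae_iff] using measure_rnRatio_eq_top (P := P) (Q := Q)

/-- Lebesgue decomposition of `P` with respect to `Q` through the ratio `dP/dQ`. -/
lemma measure_eq_setLIntegral_rnRatio_add {A : Set Ω} (hA : MeasurableSet A) :
    P A = ∫⁻ ω in A, rnRatio P Q ω ∂Q + P (A ∩ {ω | rnRatio P Q ω = ⊤}) := by
  set S := {ω | rnRatio P Q ω = ⊤} with hS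
  have hSm : MeasurableSet S := measurableSet_rnRatio_eq_top
  have hQ0 : Q (A ∩ S) = 0 := measure_mono_null inter_subset_right measure_rnRatio_eq_top
  have hPac : P ≪ P + Q := rfl.absolutelyContinuous.add_right _
  have hQac : Q ≪ P + Q := rfl.absolutelyContinuous.add_right' _
  have hAS := hA.diff hSm
  have key : P (A \ S) = ∫⁻ ω in A \ S, rnRatio P Q ω ∂Q := by
    have hQ := Measure.withDensity_rnDeriv_eq _ _ hQac
    calc P (A \ S) = ∫⁻ ω in A \ S, P.rnDeriv (P + Q) ω ∂(P + Q) :=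
          (Measure.setLIntegral_rnDeriv hPac _).symm
      _ = ∫⁻ ω in A \ S, (Q.rnDeriv (P + Q) * rnRatio P Q) ω ∂(P + Q) := by
          refine setLIntegral_congr_fun_ae hAS ?_
          filter_upwards [Q.rnDeriv_lt_top (P + Q)] with ω hq hω
          have hr : P.rnDeriv (P + Q) ω / Q.rnDeriv (P + Q) ω ≠ ⊤ := hω.2
          rw [Pi.mul_apply, rnRatio]
          rcases eq_or_ne (Q.rnDeriv (P + Q) ω) 0 with h0 | h0
          · by_contra hne
            refine hr ?_
            rw [h0, ENNReal.div_zero]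
            rintro h
            exact hne (by simp [h, h0])
          · rw [ENNReal.mul_div_cancel h0 hq.ne]
      _ = ∫⁻ ω in A \ S, rnRatio P Q ω ∂((P + Q).withDensity (Q.rnDeriv (P + Q))) :=
          (setLIntegral_withDensity_eq_setLIntegral_mul _ (Measure.measurable_rnDeriv _ _)
            measurable_rnRatio hAS).symm
      _ = _ := by rw [hQ]
  rw [← measure_inter_add_sdiff A hSm, key, ← lintegral_inter_add_sdiff _ A hSm,
    setLIntegral_measure_zero _ _ hQ0, zero_add, add_comm]

end Ratio

/-- The affine function `t ↦ a * t + c` lies below `h` on `[0, ∞)`, and its slope lies below the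
recession value `L`. -/
def IsAffineMinorant (h : ℝ → ℝ≥0∞) (L : ℝ≥0∞) (a c : ℝ) : Prop :=
  (∀ t, 0 ≤ t → ENNReal.ofReal (a * t + c) ≤ h t) ∧ ENNReal.ofReal a ≤ L

/-- `h` is the supremum of its affine minorants on `[0, ∞)`, except at countably many endpoints of
its domain, and `L` is the supremum of their slopes. -/
structure IsAffineEnvelope (h : ℝ → ℝ≥0∞) (L : ℝ≥0∞) (E : Set ℝ) : Prop where
  measurable : Measurable h
  countable : E.Countable
  exists_minorant : ∀ t, 0 ≤ t → t ∉ E → ∀ v < h t,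
    ∃ a c, IsAffineMinorant h L a c ∧ v < ENNReal.ofReal (a * t + c)
  endpoint : ∀ t ∈ E, ((∀ s, t < s → h s = ⊤) ∧ L = ⊤) ∨ ∀ s, s < t → h s = ⊤
  exists_slope : ∀ v < L, ∃ a c, IsAffineMinorant h L a c ∧ v < ENNReal.ofReal a

lemma IsAffineMinorant.mono {h : ℝ → ℝ≥0∞} {L : ℝ≥0∞} {a c a' c' : ℝ}
    (H : IsAffineMinorant h L a c) (ha : a' ≤ a) (hc : c' ≤ c) : IsAffineMinorant h L a' c' :=
  ⟨fun t ht => (ENNReal.ofReal_le_ofReal (by gcongr)).trans (H.1 t ht),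
    (ENNReal.ofReal_le_ofReal ha).trans H.2⟩

lemma IsAffineMinorant.exists_rat {h : ℝ → ℝ≥0∞} {L v : ℝ≥0∞} {a c t : ℝ}
    (H : IsAffineMinorant h L a c) (ht : 0 ≤ t) (hv : v < ENNReal.ofReal (a * t + c)) :
    ∃ a' c' : ℚ, IsAffineMinorant h L a' c' ∧ v < ENNReal.ofReal (a' * t + c') := by
  have hvt : v ≠ ⊤ := ne_top_of_lt hv
  have hv' : v.toReal < a * t + c := by
    rwa [← ENNReal.ofReal_toReal hvt, ENNReal.ofReal_lt_ofReal_iff_of_nonneg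
      ENNReal.toReal_nonneg] at hv
  set δ := (a * t + c - v.toReal) / (t + 1)
  have hδ : 0 < δ := div_pos (by linarith) (by linarith)
  have hδ' : δ * (t + 1) = a * t + c - v.toReal := div_mul_cancel₀ _ (by linarith)
  obtain ⟨a', ha₁, ha₂⟩ := exists_rat_btwn (show a - δ < a by linarith)
  obtain ⟨c', hc₁, hc₂⟩ := exists_rat_btwn (show c - δ < c by linarith)
  refine ⟨a', c', H.mono ha₂.le hc₂.le, ?_⟩
  rw [← ENNReal.ofReal_toReal hvt, ENNReal.ofReal_lt_ofReal_iff_of_nonneg ENNReal.toReal_nonneg]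
  nlinarith [mul_le_mul_of_nonneg_right ha₁.le ht]

lemma ofReal_mul_add_le_iff {a c : ℝ} {t x : ℝ≥0∞} (ht : t ≠ ⊤) :
    ENNReal.ofReal (a * t.toReal + c) ≤ x ↔
      ENNReal.ofReal a * t + ENNReal.ofReal c ≤
        x + (ENNReal.ofReal (-a) * t + ENNReal.ofReal (-c)) := by
  obtain rfl | hx := eq_or_ne x ⊤
  · simp
  lift t to ℝ≥0 using ht
  lift x to ℝ≥0 using hx
  simp only [ENNReal.ofReal, ENNReal.coe_toReal]
  norm_cast
  simp only [← NNReal.coe_le_coe, NNReal.coe_add, NNReal.coe_mul, Real.coe_toNNReal']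
  have h (y : ℝ) : max y 0 = y + max (-y) 0 := by
    rcases le_total 0 y with hy | hy <;> simp [hy]
  rw [h a, h c, max_le_iff, and_iff_left (NNReal.coe_nonneg x)]
  constructor <;> intro <;> linarith

section Divergence

variable {Ω : Type*} [MeasurableSpace Ω] {h : ℝ → ℝ≥0∞} {L : ℝ≥0∞} {E : Set ℝ}

/-- The measure `A ↦ ∫_A h(dP/dQ) dQ + L * P(A ∩ {dP/dQ = ∞})`, whose total mass is the divergence
with nonnegative generator `h` and recession value `L`. -/
def divMeasure (h : ℝ → ℝ≥0∞) (L : ℝ≥0∞) (P Q : Measure Ω) : Measure Ω :=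
  Q.withDensity (fun ω => h (rnRatio P Q ω).toReal) + L • P.restrict {ω | rnRatio P Q ω = ⊤}

variable {P Q : Measure Ω}

lemma divMeasure_apply {A : Set Ω} (hA : MeasurableSet A) :
    divMeasure h L P Q A =
      ∫⁻ ω in A, h (rnRatio P Q ω).toReal ∂Q + L * P (A ∩ {ω | rnRatio P Q ω = ⊤}) := by
  simp [divMeasure, withDensity_apply _ hA, Measure.restrict_apply hA]

lemma divMeasure_univ :
    divMeasure h L P Q univ =
      ∫⁻ ω, h (rnRatio P Q ω).toReal ∂Q + L * P {ω | rnRatio P Q ω = ⊤} := by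
  simp [divMeasure_apply MeasurableSet.univ]

lemma measurable_comp_rnRatio (hh : Measurable h) :
    Measurable fun ω => h (rnRatio P Q ω).toReal :=
  hh.comp measurable_rnRatio.ennreal_toReal

lemma ae_lt_top_of_divMeasure_ne_top (hh : Measurable h) (hfin : divMeasure h L P Q univ ≠ ⊤) :
    ∀ᵐ ω ∂Q, h (rnRatio P Q ω).toReal < ⊤ := by
  rw [divMeasure_univ] at hfin
  exact ae_lt_top (measurable_comp_rnRatio hh) (ENNReal.add_ne_top.1 hfin).1

lemma mul_le_divMeasure_of_ae_eq {A : Set Ω} (hA : MeasurableSet A) {t : ℝ} (ht : 0 ≤ t)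
    (H : ∀ᵐ ω ∂(Q.restrict A), rnRatio P Q ω = ENNReal.ofReal t) :
    h t * Q A ≤ divMeasure h L P Q A := by
  rw [divMeasure_apply hA]
  refine le_add_right (le_of_eq ?_)
  rw [← setLIntegral_const]
  refine lintegral_congr_ae ?_
  filter_upwards [H] with ω hω
  rw [hω, ENNReal.toReal_ofReal ht]

variable [IsFiniteMeasure P] [IsFiniteMeasure Q]

lemma IsAffineMinorant.le_divMeasure (hh : Measurable h) {a c : ℝ} (H : IsAffineMinorant h L a c)
    {A : Set Ω} (hA : MeasurableSet A) :
    ENNReal.ofReal a * P A + ENNReal.ofReal c * Q A ≤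
      divMeasure h L P Q A + (ENNReal.ofReal (-a) * P A + ENNReal.ofReal (-c) * Q A) := by
  have hr : Measurable (rnRatio P Q) := measurable_rnRatio
  have hint : ∫⁻ ω in A, (ENNReal.ofReal a * rnRatio P Q ω + ENNReal.ofReal c) ∂Q ≤
      ∫⁻ ω in A, (h (rnRatio P Q ω).toReal +
        (ENNReal.ofReal (-a) * rnRatio P Q ω + ENNReal.ofReal (-c))) ∂Q := by
    refine lintegral_mono_ae (ae_restrict_of_ae ?_)
    filter_upwards [ae_rnRatio_ne_top (P := P) (Q := Q)] with ω hω
    exact (ofReal_mul_add_le_iff hω).1 (H.1 _ ENNReal.toReal_nonneg)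
  rw [lintegral_add_left (measurable_comp_rnRatio hh), lintegral_add_right _ measurable_const,
    lintegral_add_right _ measurable_const, lintegral_const_mul _ hr, lintegral_const_mul _ hr,
    setLIntegral_const, setLIntegral_const] at hint
  have hsing : ENNReal.ofReal a * P (A ∩ {ω | rnRatio P Q ω = ⊤}) ≤
      L * P (A ∩ {ω | rnRatio P Q ω = ⊤}) := mul_le_mul_left H.2 _
  rw [divMeasure_apply hA, measure_eq_setLIntegral_rnRatio_add (P := P) (Q := Q) hA, mul_add,
    mul_add]
  calc _ = (ENNReal.ofReal a * ∫⁻ ω in A, rnRatio P Q ω ∂Q + ENNReal.ofReal c * Q A) +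
        ENNReal.ofReal a * P (A ∩ {ω | rnRatio P Q ω = ⊤}) := by ring
    _ ≤ _ := add_le_add hint hsing
    _ ≤ _ + ENNReal.ofReal (-a) * P (A ∩ {ω | rnRatio P Q ω = ⊤}) := le_self_add
    _ = _ := by ring

/-- Jensen's inequality at an endpoint of the domain of `h`, where it holds without any
semicontinuity. -/
lemma IsAffineEnvelope.mul_le_divMeasure_of_endpoint (H : IsAffineEnvelope h L E)
    (hfin : divMeasure h L P Q univ ≠ ⊤) {t : ℝ} (ht : 0 ≤ t) (htE : t ∈ E) {A : Set Ω}
    (hA : MeasurableSet A) (hPQ : P A = ENNReal.ofReal t * Q A) :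
    h t * Q A ≤ divMeasure h L P Q A := by
  have hlt := ae_lt_top_of_divMeasure_ne_top H.measurable hfin
  have hne := ae_rnRatio_ne_top (P := P) (Q := Q)
  have hdec := measure_eq_setLIntegral_rnRatio_add (P := P) (Q := Q) hA
  refine mul_le_divMeasure_of_ae_eq hA ht ?_
  rcases H.endpoint t htE with ⟨hup, rfl⟩ | hlo
  · have hsing : P (A ∩ {ω | rnRatio P Q ω = ⊤}) = 0 := by
      refine measure_mono_null inter_subset_right ?_
      by_contra h0
      rw [divMeasure_univ, ENNReal.top_mul h0] at hfin
      simp at hfin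
    rw [hsing, add_zero, hPQ, ← setLIntegral_const] at hdec
    refine ae_eq_of_ae_le_of_lintegral_le (ae_restrict_of_ae ?_) ?_ aemeasurable_const hdec.le
    · filter_upwards [hlt, hne] with ω h₁ h₂
      rw [← ENNReal.ofReal_toReal h₂]
      refine ENNReal.ofReal_le_ofReal (le_of_not_gt fun h₃ => ?_)
      exact h₁.ne (hup _ h₃)
    · rw [← hdec, setLIntegral_const]
      finiteness
  · refine (ae_eq_of_ae_le_of_lintegral_le (ae_restrict_of_ae ?_) ?_
      measurable_rnRatio.aemeasurable ?_).symm
    · filter_upwards [hlt, hne] with ω h₁ h₂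
      rw [← ENNReal.ofReal_toReal h₂]
      refine ENNReal.ofReal_le_ofReal (le_of_not_gt fun h₃ => ?_)
      exact h₁.ne (hlo _ h₃)
    · rw [setLIntegral_const]
      finiteness
    · rw [setLIntegral_const, ← hPQ, hdec]
      exact le_self_add

/-- A setwise upper bound by a measure with a singular part is an almost everywhere upper bound by
its density. -/
lemma ae_le_rnDeriv_add {m ν : Measure Ω} [IsFiniteMeasure m] [IsFiniteMeasure ν]
    {u w : Ω → ℝ≥0∞} (hu : Measurable u) (hw : Measurable w)
    (H : ∀ B, MeasurableSet B → ∫⁻ x in B, u x ∂ν ≤ m B + ∫⁻ x in B, w x ∂ν) :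
    ∀ᵐ x ∂ν, u x ≤ m.rnDeriv ν x + w x := by
  refine ae_le_of_forall_setLIntegral_le_of_sigmaFinite hu fun B hB _ => ?_
  obtain ⟨N, hN, hmN, hνN⟩ := Measure.mutuallySingular_singularPart m ν
  rw [lintegral_add_right _ hw]
  have hB' := hB.inter hN
  have hrestr {k : Ω → ℝ≥0∞} : ∫⁻ x in B ∩ N, k x ∂ν = ∫⁻ x in B, k x ∂ν := by
    refine setLIntegral_congr (inter_ae_eq_left_of_ae_eq_univ ?_)
    exact ae_eq_univ.2 hνN
  have hm : m (B ∩ N) = ∫⁻ x in B ∩ N, m.rnDeriv ν x ∂ν := by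
    conv_lhs => rw [m.haveLebesgueDecomposition_add ν]
    rw [Measure.add_apply, measure_mono_null inter_subset_right hmN, zero_add,
      withDensity_apply _ hB']
  have := H _ hB'
  rwa [hm, hrestr, hrestr, hrestr] at this

/-- Data processing inequality for divergences with a nonnegative generator. -/
lemma IsAffineEnvelope.divMeasure_map_univ_le {Ω' : Type*} [MeasurableSpace Ω']
    (H : IsAffineEnvelope h L E) {T : Ω → Ω'} (hT : Measurable T) :
    divMeasure h L (P.map T) (Q.map T) univ ≤ divMeasure h L P Q univ := by
  obtain htop | hfin := eq_or_ne (divMeasure h L P Q univ) ⊤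
  · simp [htop]
  set P' := P.map T with hP'
  set Q' := Q.map T with hQ'
  set m := (divMeasure h L P Q).map T
  have hmfin : IsFiniteMeasure m := by
    refine ⟨?_⟩
    rw [Measure.map_apply hT MeasurableSet.univ, preimage_univ]
    exact hfin.lt_top
  set S := {y | rnRatio P' Q' y = ⊤} with hS
  have hSm : MeasurableSet S := measurableSet_rnRatio_eq_top
  have hQS : Q' S = 0 := measure_rnRatio_eq_top
  have hr : Measurable (rnRatio P' Q') := measurable_rnRatio
  have hrS (B : Set Ω') (hB : MeasurableSet B) :
      P' (B \ S) = ∫⁻ y in B, rnRatio P' Q' y ∂Q' := by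
    rw [measure_eq_setLIntegral_rnRatio_add (P := P') (Q := Q') (hB.diff hSm), ← hS,
      sdiff_inter_self, measure_empty, add_zero]
    exact setLIntegral_congr (sdiff_null_ae_eq_self hQS)
  have hminor {a c : ℝ} (hac : IsAffineMinorant h L a c) {B : Set Ω'} (hB : MeasurableSet B) :
      ENNReal.ofReal a * P' B + ENNReal.ofReal c * Q' B ≤
        m B + (ENNReal.ofReal (-a) * P' B + ENNReal.ofReal (-c) * Q' B) := by
    simp only [P', Q', m, Measure.map_apply hT hB]
    exact hac.le_divMeasure H.measurable (hT hB)
  have hreg : ∀ᵐ y ∂Q', ∀ a c : ℚ, IsAffineMinorant h L a c →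
      ENNReal.ofReal (a * (rnRatio P' Q' y).toReal + c) ≤ m.rnDeriv Q' y := by
    simp only [ae_all_iff]
    intro a c hac
    have hle := ae_le_rnDeriv_add (m := m) (ν := Q')
      (u := fun y => ENNReal.ofReal a * rnRatio P' Q' y + ENNReal.ofReal c)
      (w := fun y => ENNReal.ofReal (-a) * rnRatio P' Q' y + ENNReal.ofReal (-c))
      (by fun_prop) (by fun_prop) fun B hB => by
        have := hminor hac (hB.diff hSm)
        rw [hrS B hB, measure_sdiff_null hQS] at this
        rw [lintegral_add_right _ measurable_const, lintegral_add_right _ measurable_const,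
          lintegral_const_mul _ hr, lintegral_const_mul _ hr, setLIntegral_const,
          setLIntegral_const]
        exact this.trans (by gcongr; exact sdiff_subset)
    filter_upwards [hle, ae_rnRatio_ne_top (P := P') (Q := Q')] with y h₁ h₂
    exact (ofReal_mul_add_le_iff h₂).2 h₁
  have hend : ∀ᵐ y ∂Q', ∀ t ∈ E, (rnRatio P' Q' y).toReal = t → h t ≤ m.rnDeriv Q' y := by
    rw [ae_ball_iff H.countable]
    intro t htE
    rcases lt_or_ge t 0 with ht | ht
    · exact ae_of_all _ fun y hy => absurd (hy ▸ ENNReal.toReal_nonneg) ht.not_ge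
    set F := {y | rnRatio P' Q' y = ENNReal.ofReal t} with hF
    have hFm : MeasurableSet F := hr (measurableSet_singleton _)
    have hle := ae_le_rnDeriv_add (m := m) (ν := Q') (u := F.indicator fun _ => h t)
      (w := fun _ => 0) (measurable_const.indicator hFm) measurable_const fun B hB => by
        have hBF := hB.inter hFm
        have hdisj : (B ∩ F) \ S = B ∩ F := by
          refine sdiff_eq_left.2 (disjoint_left.2 fun y hy hyS => ?_)
          have h₁ : rnRatio P' Q' y = ENNReal.ofReal t := hy.2
          exact ENNReal.ofReal_ne_top (h₁.symm.trans hyS)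
        have hPB : P' (B ∩ F) = ENNReal.ofReal t * Q' (B ∩ F) := by
          rw [← hdisj, hrS _ hBF, hdisj, ← setLIntegral_const]
          exact setLIntegral_congr_fun hBF fun y hy => hy.2
        rw [lintegral_zero, add_zero, setLIntegral_indicator hFm, setLIntegral_const, inter_comm]
        refine le_trans ?_ (measure_mono (inter_subset_left (t := F)))
        simp only [P', Q', m, Measure.map_apply hT hBF] at hPB ⊢
        exact H.mul_le_divMeasure_of_endpoint hfin ht htE (hT hBF) hPB
    filter_upwards [hle, ae_rnRatio_ne_top (P := P') (Q := Q')] with y h₁ h₂ h₃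
    have hyF : y ∈ F := by rw [hF, mem_ofPred_eq, ← h₃, ENNReal.ofReal_toReal h₂]
    simpa [hyF] using h₁
  have hdens : ∀ᵐ y ∂Q', h (rnRatio P' Q' y).toReal ≤ m.rnDeriv Q' y := by
    filter_upwards [hreg, hend] with y h₁ h₂
    by_cases hE : (rnRatio P' Q' y).toReal ∈ E
    · exact h₂ _ hE rfl
    · refine le_of_forall_lt fun v hv => ?_
      obtain ⟨a, c, hac, hva⟩ := H.exists_minorant _ ENNReal.toReal_nonneg hE v hv
      obtain ⟨a', c', hac', hva'⟩ := hac.exists_rat ENNReal.toReal_nonneg hva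
      exact hva'.trans_le (h₁ a' c' hac')
  have hsing : L * P' S ≤ m S := by
    refine ENNReal.mul_le_of_forall_lt fun v hv w hw => ?_
    obtain ⟨a, c, hac, hva⟩ := H.exists_slope v hv
    have := hminor hac hSm
    rw [ENNReal.ofReal_of_nonpos (neg_nonpos.2 (ENNReal.ofReal_pos.1 (bot_le.trans_lt hva)).le),
      hQS] at this
    simp only [mul_zero, zero_mul, add_zero] at this
    exact (mul_le_mul' hva.le hw.le).trans this
  have hint : ∫⁻ y, h (rnRatio P' Q' y).toReal ∂Q' ≤ m Sᶜ :=
    calc ∫⁻ y, h (rnRatio P' Q' y).toReal ∂Q'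
        ≤ ∫⁻ y, m.rnDeriv Q' y ∂Q' := lintegral_mono_ae hdens
      _ = ∫⁻ y in Sᶜ, m.rnDeriv Q' y ∂Q' := by
          rw [← setLIntegral_univ]
          exact (setLIntegral_congr (ae_eq_univ.2 (by rwa [compl_compl]))).symm
      _ ≤ m Sᶜ := Measure.setLIntegral_rnDeriv_le _
  calc divMeasure h L P' Q' univ ≤ m Sᶜ + m S := by
        rw [divMeasure_univ]
        exact add_le_add hint hsing
    _ = m univ := by rw [add_comm, measure_add_measure_compl hSm]
    _ = divMeasure h L P Q univ := by rw [Measure.map_apply hT MeasurableSet.univ, preimage_univ]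

end Divergence

namespace MemF

variable {f : ℝ → EReal}

lemma coe_toReal (hf : MemF f) {x : ℝ} (hx : f x ≠ ⊤) : ((f x).toReal : EReal) = f x :=
  EReal.coe_toReal hx (hf.ne_bot x)

lemma convexOn_toReal (hf : MemF f) : ConvexOn ℝ {x | f x ≠ ⊤} fun x => (f x).toReal := by
  have key {x y a b : ℝ} (hx : f x ≠ ⊤) (hy : f y ≠ ⊤) (ha : 0 ≤ a) (hb : 0 ≤ b)
      (hab : a + b = 1) :
      f (a * x + b * y) ≤ ((a * (f x).toReal + b * (f y).toReal : ℝ) : EReal) := by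
    obtain rfl : b = 1 - a := by linarith
    have := hf.convex x y a ha (by linarith)
    rwa [← hf.coe_toReal hx, ← hf.coe_toReal hy, ← EReal.coe_mul, ← EReal.coe_mul,
      ← EReal.coe_add] at this
  have hD {x y a b : ℝ} (hx : f x ≠ ⊤) (hy : f y ≠ ⊤) (ha : 0 ≤ a) (hb : 0 ≤ b)
      (hab : a + b = 1) : f (a * x + b * y) ≠ ⊤ :=
    ((key hx hy ha hb hab).trans_lt (EReal.coe_lt_top _)).ne
  refine ⟨fun x hx y hy a b ha hb hab => hD hx hy ha hb hab, fun x hx y hy a b ha hb hab => ?_⟩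
  have := key hx hy ha hb hab
  rwa [← hf.coe_toReal (hD hx hy ha hb hab), EReal.coe_le_coe_iff] at this

lemma measurable (hf : MemF f) : Measurable f := by
  refine measurable_of_Iic fun c => ?_
  induction c with
  | bot =>
    convert MeasurableSet.empty (α := ℝ)
    ext x
    simpa using hf.ne_bot x
  | top => simp
  | coe c =>
    have hset : f ⁻¹' Iic (c : EReal) = {x ∈ {x | f x ≠ ⊤} | (f x).toReal ≤ c} := by
      ext x
      constructor
      · intro hx
        have hx' : f x ≠ ⊤ := ne_top_of_le_ne_top (EReal.coe_ne_top c) hx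
        refine ⟨hx', ?_⟩
        rwa [mem_preimage, mem_Iic, ← hf.coe_toReal hx', EReal.coe_le_coe_iff] at hx
      · rintro ⟨hx', hx⟩
        rwa [mem_preimage, mem_Iic, ← hf.coe_toReal hx', EReal.coe_le_coe_iff]
    rw [hset]
    exact (hf.convexOn_toReal.convex_le c).ordConnected.measurableSet

lemma exists_subgradient (hf : MemF f) {t : ℝ} (ht : t ∈ interior {x | f x ≠ ⊤}) :
    ∃ a : ℝ, ∀ s, (((f t).toReal + a * (s - t) : ℝ) : EReal) ≤ f s := by
  have hc := hf.convexOn_toReal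
  refine ⟨derivWithin (fun x => (f x).toReal) (Ioi t) t, fun s => ?_⟩
  by_cases hs : f s = ⊤
  · simp [hs]
  rw [← hf.coe_toReal hs, EReal.coe_le_coe_iff]
  rcases lt_trichotomy s t with hst | rfl | hst
  · have h₁ := (hc.slope_le_leftDeriv_of_mem_interior hs ht hst).trans
      (hc.leftDeriv_le_rightDeriv_of_mem_interior ht)
    rw [slope_def_field, div_le_iff₀ (by linarith)] at h₁
    linarith
  · simp
  · have h₁ := hc.rightDeriv_le_slope_of_mem_interior ht hs hst
    rw [slope_def_field, le_div_iff₀ (by linarith)] at h₁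
    linarith

lemma mem_interior_of_lt_of_lt (hf : MemF f) {x t y : ℝ} (hx : f x ≠ ⊤) (hy : f y ≠ ⊤)
    (hxt : x < t) (hty : t < y) : t ∈ interior {x | f x ≠ ⊤} := by
  rw [mem_interior_iff_mem_nhds]
  refine mem_of_superset (Icc_mem_nhds hxt hty) ?_
  exact hf.convexOn_toReal.1.ordConnected.out hx hy

lemma one_mem_interior (hf : MemF f) : 1 ∈ interior {x | f x ≠ ⊤} := by
  obtain ⟨ε, hε, h⟩ := hf.one_mem_interior_dom
  rw [mem_interior_iff_mem_nhds, Metric.mem_nhds_iff]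
  exact ⟨ε, hε, fun x hx => h x hx⟩

lemma exists_subgradient_one (hf : MemF f) :
    ∃ k : ℝ, ∀ s, ((k * (s - 1) : ℝ) : EReal) ≤ f s := by
  simpa [hf.one_eq_zero] using hf.exists_subgradient hf.one_mem_interior

end MemF

lemma le_fStarZero {f : ℝ → EReal} {a c : ℝ} (h : ∀ s, ((a * s + c : ℝ) : EReal) ≤ f s) :
    (a : EReal) ≤ fStarZero f := by
  have hlim : Tendsto (fun t : ℝ => ((a + t⁻¹ * c : ℝ) : EReal)) atTop (𝓝 (a : EReal)) := by
    refine (continuous_coe_real_ereal.tendsto a).comp ?_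
    simpa using tendsto_const_nhds.add (tendsto_inv_atTop_zero.mul_const c)
  rw [← hlim.limsup_eq, fStarZero]
  refine limsup_le_limsup ?_
  filter_upwards [eventually_gt_atTop 0] with t ht
  calc ((a + t⁻¹ * c : ℝ) : EReal) = (t⁻¹ : ℝ) * ((a * t + c : ℝ) : EReal) := by
        rw [← EReal.coe_mul]
        congr 1
        field_simp
    _ ≤ _ := mul_le_mul_of_nonneg_left (h t) (by exact_mod_cast (inv_pos.2 ht).le)

lemma EReal.toENNReal_sub_coe_eq_top {x : EReal} {r : ℝ} :
    (x - r).toENNReal = ⊤ ↔ x = ⊤ := by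
  rw [toENNReal_eq_top_iff]
  induction x <;> simp [← EReal.coe_sub]

lemma EReal.coe_toENNReal_sub_add {x : EReal} {r : ℝ} (h : (r : EReal) ≤ x) :
    ((x - r).toENNReal : EReal) + r = x := by
  have h0 : (0 : EReal) ≤ x - r := by rwa [EReal.sub_nonneg] <;> simp
  rw [EReal.coe_toENNReal h0]
  exact EReal.sub_add_cancel

lemma EReal.ofReal_le_toENNReal_sub {x : EReal} {r u : ℝ} (h : (u : EReal) ≤ x) :
    ENNReal.ofReal (u - r) ≤ (x - r).toENNReal := by
  rw [← EReal.real_coe_toENNReal, EReal.coe_sub]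
  exact EReal.toENNReal_le_toENNReal (EReal.sub_le_sub h le_rfl)

/-- The generator `f` minus its supporting line of slope `k` at `1`, as a nonnegative function. -/
def excess (f : ℝ → EReal) (k : ℝ) (t : ℝ) : ℝ≥0∞ := (f t - (k * (t - 1) : ℝ)).toENNReal

/-- The recession value of `excess f k`. -/
def excessSlope (f : ℝ → EReal) (k : ℝ) : ℝ≥0∞ := (fStarZero f - k).toENNReal

section Excess

variable {f : ℝ → EReal} {k : ℝ}

lemma excess_eq_top {t : ℝ} : excess f k t = ⊤ ↔ f t = ⊤ := EReal.toENNReal_sub_coe_eq_top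

lemma isAffineMinorant_excess {a c : ℝ} (h : ∀ s, ((a * s + c : ℝ) : EReal) ≤ f s) :
    IsAffineMinorant (excess f k) (excessSlope f k) (a - k) (c + k) := by
  refine ⟨fun t _ => ?_, EReal.ofReal_le_toENNReal_sub (le_fStarZero h)⟩
  rw [show (a - k) * t + (c + k) = (a * t + c) - k * (t - 1) by ring]
  exact EReal.ofReal_le_toENNReal_sub (h t)

lemma fStarZero_eq_top_of_eventually (h : ∀ᶠ t in atTop, f t = ⊤) : fStarZero f = ⊤ := by
  have : (fun t : ℝ => ((t⁻¹ : ℝ) : EReal) * f t) =ᶠ[atTop] fun _ => ⊤ := by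
    filter_upwards [h, eventually_gt_atTop 0] with t ht ht0
    rw [ht, EReal.coe_mul_top_of_pos (inv_pos.2 ht0)]
  rw [fStarZero, limsup_congr this, limsup_const]

lemma MemF.measurable_excess (hf : MemF f) : Measurable (excess f k) := by
  unfold excess
  have := hf.measurable
  fun_prop

/-- Steep lines through a point above the domain of `f` are affine minorants of the excess. -/
lemma isAffineMinorant_of_mem_upperBounds {b M : ℝ} (hb : b ∈ upperBounds {x | f x ≠ ⊤})
    (hM : 0 ≤ M) : IsAffineMinorant (excess f k) (excessSlope f k) M (-(M * b)) := by
  have htop {s : ℝ} (hs : b < s) : f s = ⊤ := by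
    by_contra h
    exact hs.not_ge (hb h)
  refine ⟨fun t _ => ?_, ?_⟩
  · rcases le_or_gt t b with h | h
    · rw [ENNReal.ofReal_of_nonpos (by nlinarith)]
      exact bot_le
    · simp [excess_eq_top.2 (htop h)]
  · rw [excessSlope, EReal.toENNReal_sub_coe_eq_top.2
      (fStarZero_eq_top_of_eventually ((eventually_gt_atTop b).mono fun _ => htop))]
    exact le_top

lemma isAffineMinorant_of_mem_lowerBounds {b M : ℝ} (hb : b ∈ lowerBounds {x | f x ≠ ⊤})
    (hM : 0 ≤ M) : IsAffineMinorant (excess f k) (excessSlope f k) (-M) (M * b) := by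
  refine ⟨fun t _ => ?_, ?_⟩
  · rcases le_or_gt b t with h | h
    · rw [ENNReal.ofReal_of_nonpos (by nlinarith)]
      exact bot_le
    · have : f t = ⊤ := by
        by_contra h'
        exact h.not_ge (hb h')
      simp [excess_eq_top.2 this]
  · rw [ENNReal.ofReal_of_nonpos (by linarith)]
    exact bot_le

lemma exists_nonneg_lt_ofReal_mul {v : ℝ≥0∞} (hv : v ≠ ⊤) {d : ℝ} (hd : 0 < d) :
    ∃ M, 0 ≤ M ∧ v < ENNReal.ofReal (M * d) := by
  refine ⟨(v.toReal + 1) / d, by positivity, ?_⟩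
  rw [div_mul_cancel₀ _ hd.ne', ← ENNReal.ofReal_toReal hv,
    ENNReal.toReal_ofReal ENNReal.toReal_nonneg]
  exact (ENNReal.ofReal_lt_ofReal_iff (by positivity)).2 (by linarith)

lemma MemF.exists_minorant_excess (hf : MemF f) {t : ℝ}
    (htE : t ∉ {t | IsLUB {x | f x ≠ ⊤} t ∨ IsGLB {x | f x ≠ ⊤} t}) {v : ℝ≥0∞}
    (hv : v < excess f k t) :
    ∃ a c, IsAffineMinorant (excess f k) (excessSlope f k) a c ∧
      v < ENNReal.ofReal (a * t + c) := by
  have hvt : v ≠ ⊤ := ne_top_of_lt hv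
  by_cases hup : ∃ y, f y ≠ ⊤ ∧ t < y
  · by_cases hlo : ∃ x, f x ≠ ⊤ ∧ x < t
    · obtain ⟨x, hx, hxt⟩ := hlo
      obtain ⟨y, hy, hty⟩ := hup
      have ht := hf.mem_interior_of_lt_of_lt hx hy hxt hty
      obtain ⟨a, ha⟩ := hf.exists_subgradient ht
      refine ⟨_, _, isAffineMinorant_excess (a := a) (c := (f t).toReal - a * t)
        fun s => ?_, hv.trans_le (le_of_eq ?_)⟩
      · convert ha s using 2
        ring
      · rw [excess, ← hf.coe_toReal (interior_subset ht), ← EReal.coe_sub,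
          EReal.real_coe_toENNReal]
        simp only [EReal.toReal_coe]
        ring_nf
    · have ht : t ∈ lowerBounds {x | f x ≠ ⊤} := fun x hx => le_of_not_gt fun h => hlo ⟨x, hx, h⟩
      obtain ⟨b, hb, hbt⟩ : ∃ b ∈ lowerBounds {x | f x ≠ ⊤}, t < b := by
        by_contra! h
        exact htE (Or.inr ⟨ht, h⟩)
      obtain ⟨M, hM, hvM⟩ := exists_nonneg_lt_ofReal_mul hvt (sub_pos.2 hbt)
      exact ⟨_, _, isAffineMinorant_of_mem_lowerBounds hb hM, by convert hvM using 2; ring⟩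
  · have ht : t ∈ upperBounds {x | f x ≠ ⊤} := fun x hx => le_of_not_gt fun h => hup ⟨x, hx, h⟩
    obtain ⟨b, hb, hbt⟩ : ∃ b ∈ upperBounds {x | f x ≠ ⊤}, b < t := by
      by_contra! h
      exact htE (Or.inl ⟨ht, h⟩)
    obtain ⟨M, hM, hvM⟩ := exists_nonneg_lt_ofReal_mul hvt (sub_pos.2 hbt)
    exact ⟨_, _, isAffineMinorant_of_mem_upperBounds hb hM, by convert hvM using 2; ring⟩

lemma MemF.exists_slope_excess (hf : MemF f) {v : ℝ≥0∞} (hv : v < excessSlope f k) :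
    ∃ a c, IsAffineMinorant (excess f k) (excessSlope f k) a c ∧ v < ENNReal.ofReal a := by
  have hvt : v ≠ ⊤ := ne_top_of_lt hv
  by_cases hbdd : ∃ b, b ∈ upperBounds {x | f x ≠ ⊤}
  · obtain ⟨b, hb⟩ := hbdd
    obtain ⟨M, hM, hvM⟩ := exists_nonneg_lt_ofReal_mul hvt one_pos
    exact ⟨_, _, isAffineMinorant_of_mem_upperBounds hb hM, by simpa using hvM⟩
  have hlt : ((v.toReal + k : ℝ) : EReal) < fStarZero f := by
    by_contra! h
    refine hv.not_ge ?_
    calc excessSlope f k ≤ (((v.toReal + k : ℝ) : EReal) - k).toENNReal :=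
          EReal.toENNReal_le_toENNReal (EReal.sub_le_sub h le_rfl)
      _ = v := by
          rw [← EReal.coe_sub, EReal.real_coe_toENNReal, add_sub_cancel_right,
            ENNReal.ofReal_toReal hvt]
  obtain ⟨w, hw₁, hw₂⟩ := EReal.lt_iff_exists_real_btwn.1 hlt
  rw [EReal.coe_lt_coe_iff] at hw₁
  have hfreq := frequently_lt_of_lt_limsup (by isBoundedDefault) hw₂
  have hev : ∀ᶠ t : ℝ in atTop, (v.toReal + k) * (t - 1) < w * t := by
    filter_upwards [eventually_gt_atTop (-(v.toReal + k) / (w - (v.toReal + k)))] with t ht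
    rw [div_lt_iff₀ (by linarith)] at ht
    linarith
  obtain ⟨t, hwt, hvw, ht1⟩ := (hfreq.and_eventually (hev.and (eventually_gt_atTop 1))).exists
  obtain ⟨y, hy, hty⟩ : ∃ y, f y ≠ ⊤ ∧ t < y := by
    by_contra! h
    exact hbdd ⟨t, fun y hy => h y hy⟩
  have ht := hf.mem_interior_of_lt_of_lt (x := 1) (by simp [hf.one_eq_zero]) hy ht1 hty
  obtain ⟨a, ha⟩ := hf.exists_subgradient ht
  refine ⟨_, _, isAffineMinorant_excess (a := a) (c := (f t).toReal - a * t) fun s => ?_, ?_⟩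
  · convert ha s using 2
    ring
  have h₁ := ha 1
  rw [hf.one_eq_zero, ← EReal.coe_zero, EReal.coe_le_coe_iff] at h₁
  rw [← hf.coe_toReal (interior_subset ht), ← EReal.coe_mul, EReal.coe_lt_coe_iff,
    inv_mul_eq_div, lt_div_iff₀ (by linarith)] at hwt
  have h₂ : v.toReal + k < a := by
    by_contra! h
    nlinarith
  rw [← ENNReal.ofReal_toReal hvt, ENNReal.ofReal_lt_ofReal_iff_of_nonneg ENNReal.toReal_nonneg]
  linarith

lemma MemF.isAffineEnvelope_excess (hf : MemF f) :
    IsAffineEnvelope (excess f k) (excessSlope f k)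
      {t | IsLUB {x | f x ≠ ⊤} t ∨ IsGLB {x | f x ≠ ⊤} t} where
  measurable := hf.measurable_excess
  countable := by
    refine Countable.union (s := {t | IsLUB {x | f x ≠ ⊤} t}) (t := {t | IsGLB {x | f x ≠ ⊤} t})
      ?_ ?_
    · exact Subsingleton.countable fun x hx y hy => hx.unique hy
    · exact Subsingleton.countable fun x hx y hy => hx.unique hy
  exists_minorant _ _ htE _ hv := hf.exists_minorant_excess htE hv
  endpoint t ht := by
    refine ht.imp (fun h => ?_) fun h s hs => ?_
    · have htop {s : ℝ} (hs : t < s) : f s = ⊤ := by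
        by_contra h'
        exact hs.not_ge (h.1 h')
      exact ⟨fun s hs => excess_eq_top.2 (htop hs), EReal.toENNReal_sub_coe_eq_top.2
        (fStarZero_eq_top_of_eventually ((eventually_gt_atTop t).mono fun _ => htop))⟩
    · rw [excess_eq_top]
      by_contra h'
      exact hs.not_ge (h.1 h')
  exists_slope _ hv := hf.exists_slope_excess hv

end Excess

lemma EReal.toENNReal'_eq (x : EReal) : x.toENNReal' = x.toENNReal := rfl

lemma EReal.toENNReal_add_coe_add (H : ℝ≥0∞) (u : ℝ) :
    (H + u : EReal).toENNReal + ENNReal.ofReal (-u) =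
      H + ENNReal.ofReal u + (-(H + u : EReal)).toENNReal := by
  induction H with
  | top => simp
  | coe H =>
    have hH : ((H : ℝ≥0∞) : EReal) = ((H : ℝ) : EReal) := rfl
    rw [hH, ← EReal.coe_add, ← EReal.coe_neg, EReal.real_coe_toENNReal, EReal.real_coe_toENNReal]
    simp only [ENNReal.ofReal]
    norm_cast
    simp only [← NNReal.coe_inj, NNReal.coe_add, Real.coe_toNNReal']
    have h (y : ℝ) : max y 0 = y + max (-y) 0 := by
      rcases le_total 0 y with hy | hy <;> simp [hy]
    rw [h (H + u), h u]
    ring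

lemma EReal.toENNReal_neg_coe_add_le (H : ℝ≥0∞) (u : ℝ) :
    (-(H + u : EReal)).toENNReal ≤ ENNReal.ofReal (-u) := by
  rw [← EReal.real_coe_toENNReal, EReal.coe_neg]
  refine EReal.toENNReal_le_toENNReal (EReal.neg_le_neg_iff.2 ?_)
  exact le_add_of_nonneg_left (EReal.coe_ennreal_nonneg H)

section Integral

variable {Ω : Type*} [MeasurableSpace Ω]

lemma eInt_coe_add_coe {μ : Measure Ω} {H : Ω → ℝ≥0∞} {u : Ω → ℝ} (hH : Measurable H)
    (hum : Measurable u) (hu : Integrable u μ) :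
    eInt μ (fun ω => (H ω + u ω : EReal)) = ((∫⁻ ω, H ω ∂μ : ℝ≥0∞) : EReal) + (∫ ω, u ω ∂μ : ℝ) := by
  have hg : Measurable fun ω => (H ω + u ω : EReal) := by fun_prop
  have hupos : ∫⁻ ω, ENNReal.ofReal (u ω) ∂μ ≠ ⊤ := hu.lintegral_lt_top.ne
  have huneg : ∫⁻ ω, ENNReal.ofReal (-u ω) ∂μ ≠ ⊤ := hu.neg.lintegral_lt_top.ne
  have hgneg : ∫⁻ ω, (-(H ω + u ω : EReal)).toENNReal ∂μ ≠ ⊤ :=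
    ne_top_of_le_ne_top huneg (lintegral_mono fun ω => EReal.toENNReal_neg_coe_add_le _ _)
  have hsum : ∫⁻ ω, (H ω + u ω : EReal).toENNReal ∂μ + ∫⁻ ω, ENNReal.ofReal (-u ω) ∂μ =
      ∫⁻ ω, H ω ∂μ + ∫⁻ ω, ENNReal.ofReal (u ω) ∂μ +
        ∫⁻ ω, (-(H ω + u ω : EReal)).toENNReal ∂μ := by
    rw [← lintegral_add_left hg.ereal_toENNReal, ← lintegral_add_left hH,
      ← lintegral_add_left (by fun_prop)]
    exact lintegral_congr fun ω => EReal.toENNReal_add_coe_add _ _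
  rw [eInt, integral_eq_lintegral_pos_part_sub_lintegral_neg_part hu]
  simp only [EReal.toENNReal'_eq]
  generalize ∫⁻ ω, (H ω + u ω : EReal).toENNReal ∂μ = a at *
  generalize ∫⁻ ω, ENNReal.ofReal (-u ω) ∂μ = b at *
  generalize ∫⁻ ω, H ω ∂μ = c at *
  generalize ∫⁻ ω, ENNReal.ofReal (u ω) ∂μ = d at *
  generalize ∫⁻ ω, (-(H ω + u ω : EReal)).toENNReal ∂μ = e at *
  lift b to ℝ≥0 using huneg
  lift d to ℝ≥0 using hupos
  lift e to ℝ≥0 using hgneg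
  have hcoe (x : ℝ≥0) : ((x : ℝ≥0∞) : EReal) = ((x : ℝ) : EReal) := rfl
  induction c with
  | top =>
    obtain rfl : a = ⊤ := by simpa [ENNReal.add_eq_top] using hsum
    simp only [hcoe, EReal.coe_ennreal_top, EReal.top_sub_coe, EReal.top_add_coe]
  | coe c =>
    have ha : a ≠ ⊤ := by
      rintro rfl
      exact absurd hsum (by simp [ENNReal.add_eq_top, eq_comm])
    lift a to ℝ≥0 using ha
    have hreal : (a + b : ℝ) = c + d + e := by exact_mod_cast hsum
    simp only [hcoe, ← EReal.coe_sub, ← EReal.coe_add, ENNReal.coe_toReal]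
    congr 1
    linarith

lemma eInt_congr_ae {μ : Measure Ω} {g₁ g₂ : Ω → EReal} (h : g₁ =ᵐ[μ] g₂) :
    eInt μ g₁ = eInt μ g₂ := by
  have hpos : ∫⁻ ω, (g₁ ω).toENNReal' ∂μ = ∫⁻ ω, (g₂ ω).toENNReal' ∂μ :=
    lintegral_congr_ae (h.mono fun ω hω => by simp only [hω])
  have hneg : ∫⁻ ω, (-(g₁ ω)).toENNReal' ∂μ = ∫⁻ ω, (-(g₂ ω)).toENNReal' ∂μ :=
    lintegral_congr_ae (h.mono fun ω hω => by simp only [hω])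
  rw [eInt, eInt, hpos, hneg]

/-- The `f`-divergence of probability measures does not change when a supporting line at `1` is
subtracted from `f`. -/
lemma MemF.fDiv_eq_divMeasure {f : ℝ → EReal} (hf : MemF f) {k : ℝ}
    (hk : ∀ s, ((k * (s - 1) : ℝ) : EReal) ≤ f s) (P Q : Measure Ω) [IsProbabilityMeasure P]
    [IsProbabilityMeasure Q] :
    fDiv f P Q = divMeasure (excess f k) (excessSlope f k) P Q univ := by
  have hr : Measurable (rnRatio P Q) := measurable_rnRatio
  have hdec := measure_eq_setLIntegral_rnRatio_add (P := P) (Q := Q) MeasurableSet.univ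
  simp only [measure_univ, setLIntegral_univ, univ_inter] at hdec
  have hrfin : ∫⁻ ω, rnRatio P Q ω ∂Q ≠ ⊤ := fun h => by simp [h] at hdec
  have hSfin : P {ω | rnRatio P Q ω = ⊤} ≠ ⊤ := measure_ne_top _ _
  have hint : Integrable (fun ω => (rnRatio P Q ω).toReal) Q :=
    integrable_toReal_of_lintegral_ne_top hr.aemeasurable hrfin
  have hmass : ∫ ω, (rnRatio P Q ω).toReal ∂Q + (P {ω | rnRatio P Q ω = ⊤}).toReal = 1 := by
    rw [integral_toReal hr.aemeasurable (ae_lt_top hr hrfin), ← ENNReal.toReal_add hrfin hSfin,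
      ← hdec, ENNReal.toReal_one]
  have hslope : (k : EReal) ≤ fStarZero f :=
    le_fStarZero (c := -k) fun s => by
      convert hk s using 2
      ring
  have hae : (fun ω => extF f (rnRatio P Q ω)) =ᵐ[Q] fun ω =>
      (excess f k (rnRatio P Q ω).toReal + (k * ((rnRatio P Q ω).toReal - 1) : ℝ) : EReal) := by
    filter_upwards [ae_rnRatio_ne_top (P := P) (Q := Q)] with ω hω
    rw [extF, if_neg hω]
    exact (EReal.coe_toENNReal_sub_add (hk _)).symm
  have hlin : ∫ ω, k * ((rnRatio P Q ω).toReal - 1) ∂Q =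
      -(k * (P {ω | rnRatio P Q ω = ⊤}).toReal) := by
    rw [integral_const_mul, integral_sub hint (integrable_const _)]
    simp only [integral_const, probReal_univ, smul_eq_mul, mul_one]
    rw [← hmass]
    ring
  have hu : Integrable (fun ω => k * ((rnRatio P Q ω).toReal - 1)) Q :=
    (hint.sub (integrable_const _)).const_mul k
  rw [fDiv, eInt_congr_ae hae, eInt_coe_add_coe (measurable_comp_rnRatio hf.measurable_excess)
    (by fun_prop) hu, hlin, divMeasure_univ, EReal.coe_ennreal_add, EReal.coe_ennreal_mul,
    ← EReal.coe_toENNReal_sub_add hslope, ← excessSlope]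
  set σ := P {ω | rnRatio P Q ω = ⊤}
  have hσ : (σ : EReal) = (σ.toReal : EReal) := (EReal.coe_ennreal_toReal hSfin).symm
  rw [hσ, EReal.right_distrib_of_nonneg_of_ne_top (EReal.coe_nonneg.2 ENNReal.toReal_nonneg)
    (EReal.coe_ne_top _), add_assoc, add_left_comm _ _ ((k : EReal) * _), ← EReal.coe_mul,
    ← EReal.coe_add, neg_add_cancel, EReal.coe_zero, add_zero]

/-- Data processing inequality for `f`-divergences. -/
lemma MemF.fDiv_map_le {Ω' : Type*} [MeasurableSpace Ω'] {f : ℝ → EReal} (hf : MemF f)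
    (P Q : Measure Ω) [IsProbabilityMeasure P] [IsProbabilityMeasure Q] {T : Ω → Ω'}
    (hT : Measurable T) : fDiv f (P.map T) (Q.map T) ≤ fDiv f P Q := by
  obtain ⟨k, hk⟩ := hf.exists_subgradient_one
  have := Measure.isProbabilityMeasure_map (μ := P) hT.aemeasurable
  have := Measure.isProbabilityMeasure_map (μ := Q) hT.aemeasurable
  rw [hf.fDiv_eq_divMeasure hk, hf.fDiv_eq_divMeasure hk, EReal.coe_ennreal_le_coe_ennreal_iff]
  exact hf.isAffineEnvelope_excess.divMeasure_map_univ_le hT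

end Integral

/-- **Variable transformation reduces the Csiszár index.** For random variables `X₁, X₂` and
measurable maps `φ₁, φ₂`, one has `S_f(φ₁(X₁), φ₂(X₂)) ≤ S_f(X₁, X₂)` for every `f ∈ 𝔽`. -/
theorem csiszarIndex_map_le
    {Ω Ω₁ Ω₂ E₁ E₂ : Type*} [MeasurableSpace Ω] [MeasurableSpace Ω₁] [MeasurableSpace Ω₂]
    [MeasurableSpace E₁] [MeasurableSpace E₂]
    (μ : Measure Ω) [IsProbabilityMeasure μ]
    (X₁ : Ω → Ω₁) (X₂ : Ω → Ω₂) (hX₁ : Measurable X₁) (hX₂ : Measurable X₂)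
    (φ₁ : Ω₁ → E₁) (φ₂ : Ω₂ → E₂) (hφ₁ : Measurable φ₁) (hφ₂ : Measurable φ₂)
    (f : ℝ → EReal) (hf : MemF f) :
    csiszarIndex f μ (fun ω => φ₁ (X₁ ω)) (fun ω => φ₂ (X₂ ω)) ≤ csiszarIndex f μ X₁ X₂ := by
  have hX : Measurable fun ω => (X₁ ω, X₂ ω) := hX₁.prodMk hX₂
  have hT : Measurable (Prod.map φ₁ φ₂) := hφ₁.prodMap hφ₂
  have := Measure.isProbabilityMeasure_map (μ := μ) hX₁.aemeasurable
  have := Measure.isProbabilityMeasure_map (μ := μ) hX₂.aemeasurable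
  have := Measure.isProbabilityMeasure_map (μ := μ) hX.aemeasurable
  have hP : (μ.map fun ω => φ₁ (X₁ ω)).prod (μ.map fun ω => φ₂ (X₂ ω)) =
      ((μ.map X₁).prod (μ.map X₂)).map (Prod.map φ₁ φ₂) := by
    rw [← Measure.map_prod_map _ _ hφ₁ hφ₂, Measure.map_map hφ₁ hX₁, Measure.map_map hφ₂ hX₂]
    rfl
  have hQ : (μ.map fun ω => (φ₁ (X₁ ω), φ₂ (X₂ ω))) =
      (μ.map fun ω => (X₁ ω, X₂ ω)).map (Prod.map φ₁ φ₂) := by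
    rw [Measure.map_map hT hX]
    rfl
  rw [csiszarIndex, csiszarIndex, hP, hQ]
  exact hf.fDiv_map_le _ _ hT
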